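/- Suppose B₁, B₂, B₃ are pairwise distinct and each is strictly less than B₀. Then, for any A₀, A₁, A₂, A₃ ∈ ℝ, the set of points of LC⁺ at which V restricted to LC⁺ attains a local minimum has at most two elements. (The most general quadratic-plus-quartic potential with two order parameters has at most two distinct local minima in the orbit space.) -/

import Mathlib

/-- The forward lightcone in ℝ⁴. -/
def LCplus : Set (Fin 4 → ℝ) :=
  {r | 0 ≤ r 0 ∧ (r 0) ^ 2 = (r 1) ^ 2 + (r 2) ^ 2 + (r 3) ^ 2}

/-- The Landau potential in the diagonal frame. -/
noncomputable def V (A₀ A₁ A₂ A₃ B₀ B₁ B₂ B₃ : ℝ) (r : Fin 4 → ℝ) : ℝ :=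
  -(A₀ * r 0 - A₁ * r 1 - A₂ * r 2 - A₃ * r 3) +
    (1 / 2) * (B₀ * (r 0) ^ 2 - B₁ * (r 1) ^ 2 - B₂ * (r 2) ^ 2 - B₃ * (r 3) ^ 2)

open Filter Topology

/-- The reduced potential on `ℝ³`. -/
noncomputable def redF (A a₁ a₂ a₃ c₁ c₂ c₃ x y z : ℝ) : ℝ :=
  -(A * Real.sqrt (x ^ 2 + y ^ 2 + z ^ 2)) + (a₁ * x + a₂ * y + a₃ * z)
    + (1 / 2) * (c₁ * x ^ 2 + c₂ * y ^ 2 + c₃ * z ^ 2)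

/-- Local minimum along every line. -/
def LineMin (A a₁ a₂ a₃ c₁ c₂ c₃ x y z : ℝ) : Prop :=
  ∀ u v w : ℝ, ∀ᶠ t in 𝓝 (0 : ℝ), redF A a₁ a₂ a₃ c₁ c₂ c₃ x y z ≤
    redF A a₁ a₂ a₃ c₁ c₂ c₃ (x + t * u) (y + t * v) (z + t * w)

/-- Second-order necessary conditions at a point other than the origin. -/
structure Crit (A a₁ a₂ a₃ c₁ c₂ c₃ x y z R L : ℝ) : Prop where
  hR : 0 < R
  hL : 0 < L
  hN : R ^ 2 = x ^ 2 + y ^ 2 + z ^ 2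
  hLR : L * R = A
  e1 : (c₁ - L) * x = -a₁
  e2 : (c₂ - L) * y = -a₂
  e3 : (c₃ - L) * z = -a₃
  so : ∀ u v w : ℝ, 0 ≤ R ^ 2 * ((c₁ - L) * u ^ 2 + (c₂ - L) * v ^ 2 + (c₃ - L) * w ^ 2)
    + L * (x * u + y * v + z * w) ^ 2

lemma nonneg_of_right {g : ℝ → ℝ} (hg : Continuous g)
    (h : ∀ᶠ t in 𝓝[>] (0 : ℝ), 0 ≤ g t) : 0 ≤ g 0 :=
  ge_of_tendsto (hg.continuousAt.tendsto.mono_left nhdsWithin_le_nhds) h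

lemma poly_min {a b : ℝ} {k : ℝ → ℝ} (hk : Continuous k)
    (h : ∀ᶠ t in 𝓝 (0 : ℝ), 0 ≤ a * t + b * t ^ 2 + t ^ 3 * k t) : a = 0 ∧ 0 ≤ b := by
  have h1 : 0 ≤ a := by
    have := nonneg_of_right (g := fun t => a + b * t + t ^ 2 * k t) (by fun_prop) (by
      filter_upwards [h.filter_mono nhdsWithin_le_nhds, self_mem_nhdsWithin] with t ht ht0
      have ht0 : 0 < t := ht0
      have : 0 ≤ t * (a + b * t + t ^ 2 * k t) := by linarith
      exact nonneg_of_mul_nonneg_right this ht0)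
    simpa using this
  have h2 : a ≤ 0 := by
    have hneg : ∀ᶠ t in 𝓝 (0 : ℝ), 0 ≤ a * (-t) + b * (-t) ^ 2 + (-t) ^ 3 * k (-t) := by
      have : Tendsto (fun t : ℝ => -t) (𝓝 0) (𝓝 0) := by
        simpa using (continuous_neg (G := ℝ)).tendsto 0
      exact this.eventually h
    have := nonneg_of_right (g := fun t => -a + b * t - t ^ 2 * k (-t)) (by fun_prop) (by
      filter_upwards [hneg.filter_mono nhdsWithin_le_nhds, self_mem_nhdsWithin] with t ht ht0
      have ht0 : 0 < t := ht0
      have : 0 ≤ t * (-a + b * t - t ^ 2 * k (-t)) := by linarith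
      exact nonneg_of_mul_nonneg_right this ht0)
    simp at this
    linarith
  have ha : a = 0 := le_antisymm h2 h1
  refine ⟨ha, ?_⟩
  have := nonneg_of_right (g := fun t => b + t * k t) (by fun_prop) (by
      filter_upwards [h.filter_mono nhdsWithin_le_nhds, self_mem_nhdsWithin] with t ht ht0
      have ht0 : 0 < t := ht0
      rw [ha] at ht
      have : 0 ≤ t ^ 2 * (b + t * k t) := by linarith
      exact nonneg_of_mul_nonneg_right this (by positivity))
  simpa using this

lemma sqrt_lower {e : ℝ} (h1 : -(1 / 2) ≤ e) (h2 : e ≤ 1 / 2) :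
    1 + e / 2 - e ^ 2 / 8 + e ^ 3 / 16 - e ^ 4 ≤ Real.sqrt (1 + e) := by
  apply Real.le_sqrt_of_sq_le
  have key : (1 + e / 2 - e ^ 2 / 8 + e ^ 3 / 16 - e ^ 4) ^ 2 - (1 + e)
      = e ^ 4 * (5 / 64 - 1 / 64 * e + 1 / 256 * e ^ 2
          - 2 - e + e ^ 2 / 4 - e ^ 3 / 8 + e ^ 4) := by ring
  have e2 : e ^ 2 ≤ 1 / 4 := by nlinarith
  have e4 : e ^ 4 ≤ 1 / 16 := by nlinarith [sq_nonneg e]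
  have e3 : -(1 / 8) ≤ e ^ 3 := by nlinarith [sq_nonneg e]
  have : (5 / 64 - 1 / 64 * e + 1 / 256 * e ^ 2
          - 2 - e + e ^ 2 / 4 - e ^ 3 / 8 + e ^ 4) ≤ 0 := by linarith
  have h4 : 0 ≤ e ^ 4 := by positivity
  nlinarith [mul_nonneg h4 (neg_nonneg.2 this)]

lemma line_cond {A a₁ a₂ a₃ c₁ c₂ c₃ x y z R L : ℝ} (hA : 0 < A)
    (h : LineMin A a₁ a₂ a₃ c₁ c₂ c₃ x y z) (hR : 0 < R) (hN : R ^ 2 = x ^ 2 + y ^ 2 + z ^ 2)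
    (hLR : L * R = A) (u v w : ℝ) :
    (a₁ + (c₁ - L) * x) * u + (a₂ + (c₂ - L) * y) * v + (a₃ + (c₃ - L) * z) * w = 0 ∧
    0 ≤ R ^ 2 * ((c₁ - L) * u ^ 2 + (c₂ - L) * v ^ 2 + (c₃ - L) * w ^ 2)
    + L * (x * u + y * v + z * w) ^ 2 := by
  set β := x * u + y * v + z * w with hβ
  set γ := u ^ 2 + v ^ 2 + w ^ 2 with hγ
  let g : ℝ → ℝ := fun t => (2 * β + t * γ) / R ^ 2
  have hg : Continuous g := by fun_prop
  have hRne : R ≠ 0 := hR.ne'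
  have hsm : ∀ᶠ t in 𝓝 (0 : ℝ), t * g t ∈ Set.Icc (-(1 / 2) : ℝ) (1 / 2) := by
    have : Tendsto (fun t => t * g t) (𝓝 0) (𝓝 0) := by
      have hcont : Continuous (fun t => t * g t) := by fun_prop
      have := hcont.tendsto 0
      simpa using this
    exact this.eventually (Icc_mem_nhds (by norm_num) (by norm_num))
  have hfin := poly_min (a := (a₁ + (c₁ - L) * x) * u + (a₂ + (c₂ - L) * y) * v + (a₃ + (c₃ - L) * z) * w)
    (b := (1 / 2) * ((c₁ - L) * u ^ 2 + (c₂ - L) * v ^ 2 + (c₃ - L) * w ^ 2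
      + L * β ^ 2 / R ^ 2))
    (k := fun t => A * R * ((4 * β * γ + t * γ ^ 2) / (8 * R ^ 4) - (g t) ^ 3 / 16 + t * (g t) ^ 4))
    (by fun_prop) (by
      filter_upwards [h u v w, hsm] with t ht hs
      have hs' := sqrt_lower hs.1 hs.2
      have hsq : (x + t * u) ^ 2 + (y + t * v) ^ 2 + (z + t * w) ^ 2
          = R ^ 2 * (1 + t * g t) := by
        simp only [g]
        field_simp
        rw [hN]; ring
      unfold redF at ht
      rw [hsq, ← hN, Real.sqrt_mul (sq_nonneg R), Real.sqrt_sq hR.le] at ht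
      have hmul := mul_le_mul_of_nonneg_left hs' (mul_pos hA hR).le
      have hid : (a₁ + (c₁ - L) * x) * u + (a₂ + (c₂ - L) * y) * v + (a₃ + (c₃ - L) * z) * w
          = (a₁ + c₁ * x) * u + (a₂ + c₂ * y) * v + (a₃ + c₃ * z) * w - L * β := by
        rw [hβ]; ring
      have hid2 : (c₁ - L) * u ^ 2 + (c₂ - L) * v ^ 2 + (c₃ - L) * w ^ 2
          = c₁ * u ^ 2 + c₂ * v ^ 2 + c₃ * w ^ 2 - L * γ := by
        rw [hγ]; ring
      have hexp : A * R * ((t * g t) / 2 - (t * g t) ^ 2 / 8)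
          = L * β * t + L * γ / 2 * t ^ 2 - L * β ^ 2 / R ^ 2 / 2 * t ^ 2
            - t ^ 3 * (A * R * ((4 * β * γ + t * γ ^ 2) / (8 * R ^ 4))) := by
        simp only [g]
        rw [← hLR]
        field_simp
        ring
      rw [hid, hid2]
      linarith)
  refine ⟨hfin.1, ?_⟩
  have h2 := mul_nonneg hfin.2 (sq_nonneg R)
  have : (1 / 2) * ((c₁ - L) * u ^ 2 + (c₂ - L) * v ^ 2 + (c₃ - L) * w ^ 2
      + L * β ^ 2 / R ^ 2) * R ^ 2 = (1 / 2) * (R ^ 2 * ((c₁ - L) * u ^ 2 + (c₂ - L) * v ^ 2 + (c₃ - L) * w ^ 2)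
    + L * β ^ 2) := by
    field_simp
  linarith

lemma origin_not {A a₁ a₂ a₃ c₁ c₂ c₃ : ℝ} (hA : 0 < A)
    (h : LineMin A a₁ a₂ a₃ c₁ c₂ c₃ 0 0 0) : False := by
  have h1 := h 1 0 0
  have h2 := h (-1) 0 0
  have := nonneg_of_right (g := fun t => -(2 * A) + c₁ * t) (by fun_prop) (by
      filter_upwards [h1.filter_mono nhdsWithin_le_nhds, h2.filter_mono nhdsWithin_le_nhds,
        self_mem_nhdsWithin] with t ht ht' ht0
      have ht0 : 0 < t := ht0
      simp [redF, Real.sqrt_sq ht0.le] at ht ht'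
      have : 0 ≤ t * (-(2 * A) + c₁ * t) := by nlinarith
      exact nonneg_of_mul_nonneg_right this ht0)
  simp at this
  linarith

lemma crit_of {A a₁ a₂ a₃ c₁ c₂ c₃ x y z : ℝ} (hA : 0 < A)
    (h : LineMin A a₁ a₂ a₃ c₁ c₂ c₃ x y z) :
    ∃ R L, Crit A a₁ a₂ a₃ c₁ c₂ c₃ x y z R L := by
  by_cases h0 : x ^ 2 + y ^ 2 + z ^ 2 = 0
  · exfalso
    have hx : x = 0 := by nlinarith [sq_nonneg x, sq_nonneg y, sq_nonneg z]
    have hy : y = 0 := by nlinarith [sq_nonneg x, sq_nonneg y, sq_nonneg z]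
    have hz : z = 0 := by nlinarith [sq_nonneg x, sq_nonneg y, sq_nonneg z]
    subst hx hy hz
    exact origin_not hA h
  have hpos : 0 < x ^ 2 + y ^ 2 + z ^ 2 := lt_of_le_of_ne (by positivity) (Ne.symm h0)
  have hR := Real.sqrt_pos.2 hpos
  have hN := Real.sq_sqrt hpos.le
  set R := Real.sqrt (x ^ 2 + y ^ 2 + z ^ 2)
  have hLR : A / R * R = A := by field_simp
  have key := line_cond hA h hR hN hLR
  refine ⟨R, A / R, hR, by positivity, hN, hLR, ?_, ?_, ?_, fun u v w => (key u v w).2⟩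
  · have := (key 1 0 0).1
    linarith
  · have := (key 0 1 0).1
    linarith
  · have := (key 0 0 1).1
    linarith

lemma crit_le {A a₁ a₂ a₃ c₁ c₂ c₃ x y z R L : ℝ} (h12 : c₁ < c₂)
    (h : Crit A a₁ a₂ a₃ c₁ c₂ c₃ x y z R L) : L ≤ c₂ := by
  by_contra! hc
  have hR2 : 0 < R ^ 2 := pow_pos h.hR 2
  have h1 := h.so (-y) x 0
  have h2 := h.so 1 0 0
  have h1' : 0 ≤ R ^ 2 * ((c₁ - L) * y ^ 2 + (c₂ - L) * x ^ 2) := by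
    nlinarith
  have h1'' := nonneg_of_mul_nonneg_right h1' hR2
  have hx : x ^ 2 = 0 := by
    by_contra hx
    have : 0 < x ^ 2 := lt_of_le_of_ne (sq_nonneg x) (Ne.symm hx)
    nlinarith [sq_nonneg y]
  have hx : x = 0 := by simpa using hx
  subst hx
  nlinarith

lemma crit_x_ne {A a₁ a₂ a₃ c₁ c₂ c₃ x y z R L : ℝ}
    (h : Crit A a₁ a₂ a₃ c₁ c₂ c₃ x y z R L) (hL : c₁ < L) : x ≠ 0 := by
  rintro rfl
  have hR2 : 0 < R ^ 2 := pow_pos h.hR 2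
  have h2 := h.so 1 0 0
  nlinarith

lemma crit_y_zero {A a₁ a₂ a₃ c₁ c₂ c₃ x y z R L : ℝ} (h12 : c₁ < c₂)
    (h : Crit A a₁ a₂ a₃ c₁ c₂ c₃ x y z R L) (hL : L = c₂) : y = 0 := by
  have hR2 : 0 < R ^ 2 := pow_pos h.hR 2
  have h1 := h.so (-y) x 0
  subst hL
  have h1' : 0 ≤ R ^ 2 * ((c₁ - L) * y ^ 2) := by
    nlinarith
  have h1'' := nonneg_of_mul_nonneg_right h1' hR2
  have : y ^ 2 = 0 := by nlinarith [sq_nonneg y]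
  simpa using this

lemma sq_le_aux {p q x y : ℝ} (h0 : 0 ≤ q) (hpq : q < p) (h : p * x = q * y) :
    x ^ 2 ≤ y ^ 2 := by
  have hp : 0 < p := by linarith
  have h1 : p ^ 2 * x ^ 2 = q ^ 2 * y ^ 2 := by rw [← mul_pow, ← mul_pow, h]
  have h2 : q ^ 2 * y ^ 2 ≤ p ^ 2 * y ^ 2 := by gcongr
  exact le_of_mul_le_mul_left (by linarith) (pow_pos hp 2)

lemma low_low_lt {A a₁ a₂ a₃ c₁ c₂ c₃ x y z R L x' y' z' R' L' : ℝ} (h12 : c₁ < c₂)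
    (h23 : c₂ < c₃) (h : Crit A a₁ a₂ a₃ c₁ c₂ c₃ x y z R L)
    (h' : Crit A a₁ a₂ a₃ c₁ c₂ c₃ x' y' z' R' L') (hlow : L' ≤ c₁) : L' ≤ L := by
  by_contra! hlt
  have e1 : x ^ 2 ≤ x' ^ 2 := sq_le_aux (p := c₁ - L) (q := c₁ - L') (by linarith) (by linarith)
    (by rw [h.e1, h'.e1])
  have e2 : y ^ 2 ≤ y' ^ 2 := sq_le_aux (p := c₂ - L) (q := c₂ - L') (by linarith) (by linarith)
    (by rw [h.e2, h'.e2])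
  have e3 : z ^ 2 ≤ z' ^ 2 := sq_le_aux (p := c₃ - L) (q := c₃ - L') (by linarith) (by linarith)
    (by rw [h.e3, h'.e3])
  have hRR : R ^ 2 ≤ R' ^ 2 := by rw [h.hN, h'.hN]; linarith
  have hRR' : R ≤ R' := (sq_le_sq₀ h.hR.le h'.hR.le).1 hRR
  have := h.hLR
  have := h'.hLR
  nlinarith [h.hR, h'.hR, h.hL, h'.hL]

lemma tangent {c L M x y : ℝ} (hc : 0 < c) (hL : 0 < L) (hLM : L < M)
    (hcase : c < L ∨ M < c) (h : (c - L) * x = (c - M) * y) (hy : y ≠ 0) :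
    M ^ 2 * y ^ 2 + 2 * M * (L - M) * (y ^ 2 * c / (c - M)) < L ^ 2 * x ^ 2 := by
  have ha : c - L ≠ 0 := by
    rcases hcase with h | h
    · exact (by linarith : c - L < 0).ne
    · exact (by linarith : 0 < c - L).ne'
  have hb : c - M ≠ 0 := by
    rcases hcase with h | h
    · exact (by linarith : c - M < 0).ne
    · exact (by linarith : 0 < c - M).ne'
  have hx : x = (c - M) * y / (c - L) := by
    field_simp
    linarith
  have hpos : 0 < 2 * L / c - 1 + 2 * ((c - L) / (c - M)) := by
    rcases hcase with h | h
    · have h1 : 0 < (c - L) / (c - M) := div_pos_of_neg_of_neg (by linarith) (by linarith)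
      have h2 : 1 < L / c := (one_lt_div hc).2 h
      have : 2 * L / c = 2 * (L / c) := by ring
      linarith
    · have h1 : 1 < (c - L) / (c - M) := (one_lt_div (by linarith)).2 (by linarith)
      have : 0 < 2 * L / c := by positivity
      linarith
  have key : L ^ 2 * x ^ 2 - (M ^ 2 * y ^ 2 + 2 * M * (L - M) * (y ^ 2 * c / (c - M)))
      = y ^ 2 * c ^ 2 * (M - L) ^ 2 / (c - L) ^ 2 *
        (2 * L / c - 1 + 2 * ((c - L) / (c - M))) := by
    rw [hx]
    field_simp
    ring
  have hML : 0 < M - L := by linarith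
  have : 0 < y ^ 2 * c ^ 2 * (M - L) ^ 2 / (c - L) ^ 2 *
        (2 * L / c - 1 + 2 * ((c - L) / (c - M))) := by
    have : 0 < (c - L) ^ 2 := by positivity
    positivity
  linarith

lemma tangent_le {c L M x y : ℝ} (hc : 0 < c) (hL : 0 < L) (hLM : L < M)
    (hcase : c < L ∨ M < c) (h : (c - L) * x = (c - M) * y) :
    M ^ 2 * y ^ 2 + 2 * M * (L - M) * (y ^ 2 * c / (c - M)) ≤ L ^ 2 * x ^ 2 := by
  by_cases hy : y = 0
  · subst hy
    simp
    positivity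
  · exact (tangent hc hL hLM hcase h hy).le

lemma high_D {A a₁ a₂ a₃ c₁ c₂ c₃ x y z R L : ℝ} (h12 : c₁ < c₂) (h23 : c₂ < c₃)
    (h : Crit A a₁ a₂ a₃ c₁ c₂ c₃ x y z R L) (hL : c₁ < L) :
    x ^ 2 * c₁ / (c₁ - L) + y ^ 2 * c₂ / (c₂ - L) + z ^ 2 * c₃ / (c₃ - L) ≤ 0 := by
  have hle := crit_le h12 h
  have hLp := h.hL
  have hRp : 0 < R ^ 2 := pow_pos h.hR 2
  have hne1 : c₁ - L ≠ 0 := (by linarith : c₁ - L < 0).ne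
  have hne3 : c₃ - L ≠ 0 := (by linarith : 0 < c₃ - L).ne'
  obtain ⟨q, hq, hqD⟩ : ∃ q, (c₂ - L) * q = y ∧ y ^ 2 * c₂ / (c₂ - L) = y ^ 2 + L * (y * q) := by
    by_cases hc : L = c₂
    · have := crit_y_zero h12 h hc
      exact ⟨0, by simp [this], by simp [this]⟩
    · have hne : c₂ - L ≠ 0 := sub_ne_zero.2 (Ne.symm hc)
      refine ⟨y / (c₂ - L), by field_simp, ?_⟩
      field_simp
      ring
  obtain ⟨s, hs, hsD⟩ : ∃ s, (c₃ - L) * s = z ∧ z ^ 2 * c₃ / (c₃ - L) = z ^ 2 + L * (z * s) := by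
    refine ⟨z / (c₃ - L), by field_simp, ?_⟩
    field_simp
    ring
  have hxD : x ^ 2 * c₁ / (c₁ - L) = x ^ 2 + L * x ^ 2 / (c₁ - L) := by
    field_simp
    ring
  have hT : 0 ≤ y * q + z * s := by
    have h1 : y * q = (c₂ - L) * q ^ 2 := by rw [← hq]; ring
    have h2 : z * s = (c₃ - L) * s ^ 2 := by rw [← hs]; ring
    rw [h1, h2]
    have : 0 ≤ c₂ - L := by linarith
    have : 0 ≤ c₃ - L := by linarith
    positivity
  set T := y * q + z * s with hTd
  have hso := h.so (R ^ 2 + L * T) (-(L * x * q)) (-(L * x * s))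
  have hK : 0 < R ^ 2 + L * T := by positivity
  have hid : R ^ 2 * ((c₁ - L) * (R ^ 2 + L * T) ^ 2 + (c₂ - L) * (-(L * x * q)) ^ 2
      + (c₃ - L) * (-(L * x * s)) ^ 2)
      + L * (x * (R ^ 2 + L * T) + y * (-(L * x * q)) + z * (-(L * x * s))) ^ 2
      = R ^ 2 * (R ^ 2 + L * T) * ((c₁ - L) * (R ^ 2 + L * T) + L * x ^ 2) := by
    have h1 : (c₂ - L) * (-(L * x * q)) ^ 2 = L ^ 2 * x ^ 2 * (y * q) := by rw [← hq]; ring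
    have h2 : (c₃ - L) * (-(L * x * s)) ^ 2 = L ^ 2 * x ^ 2 * (z * s) := by rw [← hs]; ring
    rw [h1, h2, hTd]
    ring
  rw [hid] at hso
  have h3 := nonneg_of_mul_nonneg_right hso (by positivity)
  have h4 : L * x ^ 2 / (c₁ - L) ≤ -(R ^ 2 + L * T) := by
    rw [div_le_iff_of_neg (by linarith)]
    linarith
  rw [hxD, hqD, hsD]
  have := h.hN
  linarith

lemma high_high_lt {A a₁ a₂ a₃ c₁ c₂ c₃ x y z R L x' y' z' R' L' : ℝ} (h1 : 0 < c₁)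
    (h12 : c₁ < c₂)
    (h23 : c₂ < c₃) (h : Crit A a₁ a₂ a₃ c₁ c₂ c₃ x y z R L)
    (h' : Crit A a₁ a₂ a₃ c₁ c₂ c₃ x' y' z' R' L') (hhigh : c₁ < L) : L' ≤ L := by
  by_contra! hlt
  have hD := high_D h12 h23 h' (by linarith)
  have hle := crit_le h12 h'
  have t1 := tangent h1 h.hL hlt (Or.inl hhigh) (by rw [h.e1, h'.e1])
    (crit_x_ne h' (by linarith))
  have t3 := tangent_le (c := c₃) (by linarith) h.hL hlt (Or.inr (by linarith))
    (x := z) (y := z') (by rw [h.e3, h'.e3])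
  have t2 : L' ^ 2 * y' ^ 2 + 2 * L' * (L - L') * (y' ^ 2 * c₂ / (c₂ - L')) ≤ L ^ 2 * y ^ 2 := by
    by_cases hc : L' = c₂
    · have := crit_y_zero h12 h' hc
      rw [this]
      simp
      positivity
    · exact tangent_le (by linarith) h.hL hlt (Or.inr (lt_of_le_of_ne hle hc))
        (by rw [h.e2, h'.e2])
  have hA : L ^ 2 * R ^ 2 = L' ^ 2 * R' ^ 2 := by
    rw [← mul_pow, ← mul_pow, h.hLR, h'.hLR]
  rw [h.hN, h'.hN] at hA
  have hp : 0 ≤ 2 * L' * (L' - L) := by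
    have := h'.hL
    have : 0 ≤ L' - L := by linarith
    positivity
  nlinarith [mul_nonneg hp (neg_nonneg.2 hD)]

lemma high_high {A a₁ a₂ a₃ c₁ c₂ c₃ x y z R L x' y' z' R' L' : ℝ} (h1 : 0 < c₁)
    (h12 : c₁ < c₂)
    (h23 : c₂ < c₃) (h : Crit A a₁ a₂ a₃ c₁ c₂ c₃ x y z R L)
    (h' : Crit A a₁ a₂ a₃ c₁ c₂ c₃ x' y' z' R' L') (hh : c₁ < L) (hh' : c₁ < L') :
    x = x' ∧ y = y' ∧ z = z' := by
  have hLL : L' = L := le_antisymm (high_high_lt h1 h12 h23 h h' hh)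
    (high_high_lt h1 h12 h23 h' h hh')
  subst hLL
  have hle := crit_le h12 h'
  refine ⟨?_, ?_, ?_⟩
  · exact mul_left_cancel₀ (by linarith : c₁ - L' < 0).ne (by rw [h.e1, h'.e1])
  · by_cases hc : L' = c₂
    · rw [crit_y_zero h12 h hc, crit_y_zero h12 h' hc]
    · exact mul_left_cancel₀ (sub_ne_zero.2 (Ne.symm hc)) (by rw [h.e2, h'.e2])
  · exact mul_left_cancel₀ (by linarith : 0 < c₃ - L').ne' (by rw [h.e3, h'.e3])

lemma low_low {A a₁ a₂ a₃ c₁ c₂ c₃ x y z R L x' y' z' R' L' : ℝ}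
    (h12 : c₁ < c₂)
    (h23 : c₂ < c₃) (h : Crit A a₁ a₂ a₃ c₁ c₂ c₃ x y z R L)
    (h' : Crit A a₁ a₂ a₃ c₁ c₂ c₃ x' y' z' R' L') (hh : L ≤ c₁) (hh' : L' ≤ c₁) :
    (x = x' ∨ (x = -x' ∧ a₁ = 0 ∧ x ≠ 0)) ∧ y = y' ∧ z = z' := by
  have hLL : L' = L := le_antisymm (low_low_lt h12 h23 h h' hh')
    (low_low_lt h12 h23 h' h hh)
  subst hLL
  have hy : y = y' := mul_left_cancel₀ (by linarith : 0 < c₂ - L').ne' (by rw [h.e2, h'.e2])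
  have hz : z = z' := mul_left_cancel₀ (by linarith : 0 < c₃ - L').ne' (by rw [h.e3, h'.e3])
  refine ⟨?_, hy, hz⟩
  by_cases hc : L' = c₁
  · have ha : a₁ = 0 := by
      have := h.e1
      rw [hc] at this
      linarith
    have hR : R = R' := mul_left_cancel₀ h.hL.ne' (by rw [h.hLR, h'.hLR])
    have hx : x ^ 2 = x' ^ 2 := by
      have h3 := h.hN
      have h4 := h'.hN
      rw [hR, hy, hz] at h3
      linarith
    by_cases hx0 : x = 0
    · left
      rw [hx0] at hx ⊢
      have : x' ^ 2 = 0 := by rw [← hx]; ring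
      exact (pow_eq_zero_iff (two_ne_zero)).1 this |>.symm
    · rcases sq_eq_sq_iff_eq_or_eq_neg.1 hx with h5 | h5
      · exact Or.inl h5
      · exact Or.inr ⟨h5, ha, hx0⟩
  · left
    exact mul_left_cancel₀ (sub_ne_zero.2 (Ne.symm hc)) (by rw [h.e1, h'.e1])

lemma high_a_ne {A a₁ a₂ a₃ c₁ c₂ c₃ x y z R L : ℝ}
    (h : Crit A a₁ a₂ a₃ c₁ c₂ c₃ x y z R L) (hh : c₁ < L) : a₁ ≠ 0 := by
  intro ha
  have h1 := h.e1
  rw [ha, neg_zero] at h1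
  rcases mul_eq_zero.1 h1 with h2 | h2
  · linarith
  · exact crit_x_ne h hh h2

/-- Among three critical points two coincide. -/
lemma three_crit {A a₁ a₂ a₃ c₁ c₂ c₃ x y z R L x' y' z' R' L' x'' y'' z'' R'' L'' : ℝ}
    (h1 : 0 < c₁) (h12 : c₁ < c₂) (h23 : c₂ < c₃)
    (h : Crit A a₁ a₂ a₃ c₁ c₂ c₃ x y z R L)
    (h' : Crit A a₁ a₂ a₃ c₁ c₂ c₃ x' y' z' R' L')
    (h'' : Crit A a₁ a₂ a₃ c₁ c₂ c₃ x'' y'' z'' R'' L'') :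
    (x = x' ∧ y = y' ∧ z = z') ∨ (x = x'' ∧ y = y'' ∧ z = z'') ∨
      (x' = x'' ∧ y' = y'' ∧ z' = z'') := by
  rcases le_or_gt L c₁ with l | l <;> rcases le_or_gt L' c₁ with l' | l' <;>
    rcases le_or_gt L'' c₁ with l'' | l''
  · obtain ⟨p1, p2, p3⟩ := low_low h12 h23 h h' l l'
    obtain ⟨q1, q2, q3⟩ := low_low h12 h23 h h'' l l''
    rcases p1 with p1 | ⟨p1, -, -⟩
    · exact Or.inl ⟨p1, p2, p3⟩
    rcases q1 with q1 | ⟨q1, -, -⟩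
    · exact Or.inr (Or.inl ⟨q1, q2, q3⟩)
    · exact Or.inr (Or.inr ⟨by linarith, by linarith, by linarith⟩)
  · obtain ⟨p1 | ⟨-, p1, -⟩, p2, p3⟩ := low_low h12 h23 h h' l l'
    · exact Or.inl ⟨p1, p2, p3⟩
    · exact absurd p1 (high_a_ne h'' l'')
  · obtain ⟨p1 | ⟨-, p1, -⟩, p2, p3⟩ := low_low h12 h23 h h'' l l''
    · exact Or.inr (Or.inl ⟨p1, p2, p3⟩)
    · exact absurd p1 (high_a_ne h' l')
  · exact Or.inr (Or.inr (high_high h1 h12 h23 h' h'' l' l''))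
  · obtain ⟨p1 | ⟨-, p1, -⟩, p2, p3⟩ := low_low h12 h23 h' h'' l' l''
    · exact Or.inr (Or.inr ⟨p1, p2, p3⟩)
    · exact absurd p1 (high_a_ne h l)
  · exact Or.inr (Or.inl (high_high h1 h12 h23 h h'' l l''))
  · exact Or.inl (high_high h1 h12 h23 h h' l l')
  · exact Or.inl (high_high h1 h12 h23 h h' l l')

lemma sqrt_convex (x y z x' y' z' t : ℝ) (h0 : 0 ≤ t) (h1 : t ≤ 1) :
    Real.sqrt ((x + t * (x' - x)) ^ 2 + (y + t * (y' - y)) ^ 2 + (z + t * (z' - z)) ^ 2)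
      ≤ (1 - t) * Real.sqrt (x ^ 2 + y ^ 2 + z ^ 2)
        + t * Real.sqrt (x' ^ 2 + y' ^ 2 + z' ^ 2) := by
  have hN := Real.sq_sqrt (show 0 ≤ x ^ 2 + y ^ 2 + z ^ 2 by positivity)
  have hN' := Real.sq_sqrt (show 0 ≤ x' ^ 2 + y' ^ 2 + z' ^ 2 by positivity)
  have hp := Real.sqrt_nonneg (x ^ 2 + y ^ 2 + z ^ 2)
  have hp' := Real.sqrt_nonneg (x' ^ 2 + y' ^ 2 + z' ^ 2)
  set R := Real.sqrt (x ^ 2 + y ^ 2 + z ^ 2)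
  set S := Real.sqrt (x' ^ 2 + y' ^ 2 + z' ^ 2)
  have hcs : x * x' + y * y' + z * z' ≤ R * S := by
    refine le_of_abs_le (abs_le_of_sq_le_sq ?_ (by positivity))
    rw [mul_pow, hN, hN']
    nlinarith [sq_nonneg (x * y' - y * x'), sq_nonneg (x * z' - z * x'),
      sq_nonneg (y * z' - z * y')]
  have h1' : 0 ≤ 1 - t := by linarith
  apply Real.sqrt_le_iff.2 ⟨by positivity, ?_⟩
  have h3 := mul_le_mul_of_nonneg_left hcs (mul_nonneg h0 h1')
  have : ((1 - t) * R + t * S) ^ 2 = (1 - t) ^ 2 * R ^ 2 + 2 * (t * (1 - t) * (R * S))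
    + t ^ 2 * S ^ 2 := by ring
  rw [this, hN, hN']
  linarith

lemma convex_lt {A a₁ a₂ a₃ c₁ c₂ c₃ x y z x' y' z' : ℝ} (hA : A ≤ 0)
    (h1 : 0 < c₁) (h2 : 0 < c₂) (h3 : 0 < c₃)
    (h : LineMin A a₁ a₂ a₃ c₁ c₂ c₃ x y z) (hne : ¬ (x = x' ∧ y = y' ∧ z = z')) :
    redF A a₁ a₂ a₃ c₁ c₂ c₃ x y z < redF A a₁ a₂ a₃ c₁ c₂ c₃ x' y' z' := by
  set κ := (1 / 2) * (c₁ * (x' - x) ^ 2 + c₂ * (y' - y) ^ 2 + c₃ * (z' - z) ^ 2) with hκ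
  have hκ0 : 0 < κ := by
    by_contra! hc
    have p1 : 0 ≤ c₁ * (x' - x) ^ 2 := by positivity
    have p2 : 0 ≤ c₂ * (y' - y) ^ 2 := by positivity
    have p3 : 0 ≤ c₃ * (z' - z) ^ 2 := by positivity
    have q1 : c₁ * (x' - x) ^ 2 = 0 := by linarith
    have q2 : c₂ * (y' - y) ^ 2 = 0 := by linarith
    have q3 : c₃ * (z' - z) ^ 2 = 0 := by linarith
    simp [h1.ne', h2.ne', h3.ne'] at q1 q2 q3
    exact hne ⟨by linarith, by linarith, by linarith⟩
  have := nonneg_of_right (g := fun t => redF A a₁ a₂ a₃ c₁ c₂ c₃ x' y' z'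
      - redF A a₁ a₂ a₃ c₁ c₂ c₃ x y z - κ * (1 - t)) (by fun_prop) (by
    filter_upwards [(h (x' - x) (y' - y) (z' - z)).filter_mono nhdsWithin_le_nhds,
      Ioo_mem_nhdsGT (zero_lt_one' ℝ)] with t ht ht0
    have hs := sqrt_convex x y z x' y' z' t ht0.1.le ht0.2.le
    have hs' := mul_le_mul_of_nonneg_left hs (neg_nonneg.2 hA)
    refine nonneg_of_mul_nonneg_right (a := t) ?_ ht0.1
    unfold redF at ht ⊢
    rw [hκ]
    linarith)
  simp at this
  linarith

lemma three_sorted {A a₁ a₂ a₃ c₁ c₂ c₃ x y z x' y' z' x'' y'' z'' : ℝ}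
    (h1 : 0 < c₁) (h12 : c₁ < c₂) (h23 : c₂ < c₃)
    (h : LineMin A a₁ a₂ a₃ c₁ c₂ c₃ x y z)
    (h' : LineMin A a₁ a₂ a₃ c₁ c₂ c₃ x' y' z')
    (h'' : LineMin A a₁ a₂ a₃ c₁ c₂ c₃ x'' y'' z'') :
    (x = x' ∧ y = y' ∧ z = z') ∨ (x = x'' ∧ y = y'' ∧ z = z'') ∨
      (x' = x'' ∧ y' = y'' ∧ z' = z'') := by
  rcases le_or_gt A 0 with hA | hA
  · left
    by_contra hne
    have hne' : ¬ (x' = x ∧ y' = y ∧ z' = z) := fun ⟨p, q, r⟩ => hne ⟨p.symm, q.symm, r.symm⟩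
    have := convex_lt hA h1 (by linarith) (by linarith) h hne
    have := convex_lt hA h1 (by linarith) (by linarith) h' hne'
    linarith
  · obtain ⟨R, L, k⟩ := crit_of hA h
    obtain ⟨R', L', k'⟩ := crit_of hA h'
    obtain ⟨R'', L'', k''⟩ := crit_of hA h''
    exact three_crit h1 h12 h23 k k' k''

lemma swap12 {A a₁ a₂ a₃ c₁ c₂ c₃ x y z : ℝ} (h : LineMin A a₁ a₂ a₃ c₁ c₂ c₃ x y z) :
    LineMin A a₂ a₁ a₃ c₂ c₁ c₃ y x z := by
  intro u v w
  filter_upwards [h v u w] with t ht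
  unfold redF at ht ⊢
  rw [add_comm (y ^ 2), add_comm ((y + t * u) ^ 2)]
  linarith

lemma swap23 {A a₁ a₂ a₃ c₁ c₂ c₃ x y z : ℝ} (h : LineMin A a₁ a₂ a₃ c₁ c₂ c₃ x y z) :
    LineMin A a₁ a₃ a₂ c₁ c₃ c₂ x z y := by
  intro u v w
  filter_upwards [h u w v] with t ht
  unfold redF at ht ⊢
  rw [add_right_comm (x ^ 2), add_right_comm ((x + t * u) ^ 2)]
  linarith

lemma three_any {A a₁ a₂ a₃ c₁ c₂ c₃ x y z x' y' z' x'' y'' z'' : ℝ}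
    (h1 : 0 < c₁) (h2 : 0 < c₂) (h3 : 0 < c₃) (h12 : c₁ ≠ c₂) (h13 : c₁ ≠ c₃) (h23 : c₂ ≠ c₃)
    (h : LineMin A a₁ a₂ a₃ c₁ c₂ c₃ x y z)
    (h' : LineMin A a₁ a₂ a₃ c₁ c₂ c₃ x' y' z')
    (h'' : LineMin A a₁ a₂ a₃ c₁ c₂ c₃ x'' y'' z'') :
    (x = x' ∧ y = y' ∧ z = z') ∨ (x = x'' ∧ y = y'' ∧ z = z'') ∨
      (x' = x'' ∧ y' = y'' ∧ z' = z'') := by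
  rcases lt_or_gt_of_ne h12 with a | a <;> rcases lt_or_gt_of_ne h23 with b | b <;>
    rcases lt_or_gt_of_ne h13 with c | c
  · exact three_sorted h1 a b h h' h''
  · linarith
  · have := three_sorted h1 c b (swap23 h) (swap23 h') (swap23 h'')
    tauto
  · have := three_sorted h3 c a (swap12 (swap23 h)) (swap12 (swap23 h')) (swap12 (swap23 h''))
    tauto
  · have := three_sorted h2 a c (swap12 h) (swap12 h') (swap12 h'')
    tauto
  · have := three_sorted h2 b c (swap23 (swap12 h)) (swap23 (swap12 h')) (swap23 (swap12 h''))
    tauto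
  · linarith
  · have := three_sorted h3 b a (swap12 (swap23 (swap12 h))) (swap12 (swap23 (swap12 h')))
      (swap12 (swap23 (swap12 h'')))
    tauto

lemma r0_eq {r : Fin 4 → ℝ} (hr : r ∈ LCplus) :
    r 0 = Real.sqrt ((r 1) ^ 2 + (r 2) ^ 2 + (r 3) ^ 2) := by
  rw [← hr.2, Real.sqrt_sq hr.1]

lemma V_eq {A₀ A₁ A₂ A₃ B₀ B₁ B₂ B₃ : ℝ} {r : Fin 4 → ℝ} (hr : r ∈ LCplus) :
    V A₀ A₁ A₂ A₃ B₀ B₁ B₂ B₃ r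
      = redF A₀ A₁ A₂ A₃ (B₀ - B₁) (B₀ - B₂) (B₀ - B₃) (r 1) (r 2) (r 3) := by
  unfold V redF
  rw [← r0_eq hr, hr.2]
  ring

lemma lineMin_of {A₀ A₁ A₂ A₃ B₀ B₁ B₂ B₃ : ℝ} {r : Fin 4 → ℝ} (hr : r ∈ LCplus)
    (h : IsLocalMinOn (V A₀ A₁ A₂ A₃ B₀ B₁ B₂ B₃) LCplus r) :
    LineMin A₀ A₁ A₂ A₃ (B₀ - B₁) (B₀ - B₂) (B₀ - B₃) (r 1) (r 2) (r 3) := by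
  intro u v w
  let γ : ℝ → Fin 4 → ℝ := fun t =>
    ![Real.sqrt ((r 1 + t * u) ^ 2 + (r 2 + t * v) ^ 2 + (r 3 + t * w) ^ 2),
      r 1 + t * u, r 2 + t * v, r 3 + t * w]
  have hmem : ∀ t, γ t ∈ LCplus := fun t =>
    ⟨Real.sqrt_nonneg _, Real.sq_sqrt (by positivity)⟩
  have hc : Continuous γ := by
    refine continuous_pi fun i => ?_
    fin_cases i <;> simp [γ] <;> fun_prop
  have h0 : γ 0 = r := by
    funext i
    fin_cases i <;> simp [γ]
    exact (r0_eq hr).symm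
  have ht : Tendsto γ (𝓝 0) (𝓝[LCplus] r) := by
    refine tendsto_nhdsWithin_iff.2 ⟨?_, Eventually.of_forall hmem⟩
    have := hc.tendsto 0
    rwa [h0] at this
  filter_upwards [ht.eventually h] with t hh
  rw [V_eq hr, V_eq (hmem t)] at hh
  exact hh

lemma ext_of {r s : Fin 4 → ℝ} (hr : r ∈ LCplus) (hs : s ∈ LCplus)
    (h : r 1 = s 1 ∧ r 2 = s 2 ∧ r 3 = s 3) : r = s := by
  obtain ⟨p, q, k⟩ := h
  funext i
  fin_cases i
  · show r 0 = s 0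
    rw [r0_eq hr, r0_eq hs, p, q, k]
  · exact p
  · exact q
  · exact k

/-- The Landau potential has at most two distinct local minima on the
forward lightcone. -/
theorem at_most_two_local_minima
    (A₀ A₁ A₂ A₃ B₀ B₁ B₂ B₃ : ℝ)
    (h12 : B₁ ≠ B₂) (h13 : B₁ ≠ B₃) (h23 : B₂ ≠ B₃)
    (h1 : B₁ < B₀) (h2 : B₂ < B₀) (h3 : B₃ < B₀) :
    ∃ p q : Fin 4 → ℝ,
      {r : Fin 4 → ℝ | r ∈ LCplus ∧
        IsLocalMinOn (V A₀ A₁ A₂ A₃ B₀ B₁ B₂ B₃) LCplus r} ⊆ {p, q} := by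
  set S := {r : Fin 4 → ℝ | r ∈ LCplus ∧
        IsLocalMinOn (V A₀ A₁ A₂ A₃ B₀ B₁ B₂ B₃) LCplus r} with hS
  have key : ∀ r ∈ S, ∀ s ∈ S, ∀ t ∈ S, r = s ∨ r = t ∨ s = t := by
    intro r hr s hs t ht
    rcases three_any (by linarith) (by linarith) (by linarith)
      (fun h => h12 (by linarith)) (fun h => h13 (by linarith)) (fun h => h23 (by linarith))
      (lineMin_of hr.1 hr.2) (lineMin_of hs.1 hs.2) (lineMin_of ht.1 ht.2) with h | h | h
    · exact Or.inl (ext_of hr.1 hs.1 h)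
    · exact Or.inr (Or.inl (ext_of hr.1 ht.1 h))
    · exact Or.inr (Or.inr (ext_of hs.1 ht.1 h))
  by_cases hex : ∃ p ∈ S, ∃ q ∈ S, p ≠ q
  · obtain ⟨p, hp, q, hq, hpq⟩ := hex
    refine ⟨p, q, fun r hr => ?_⟩
    rcases key p hp q hq r hr with h | h | h
    · exact absurd h hpq
    · exact Or.inl h.symm
    · exact Or.inr h.symm
  · push Not at hex
    by_cases hne : S.Nonempty
    · obtain ⟨p, hp⟩ := hne
      exact ⟨p, p, fun r hr => Or.inl (hex r hr p hp)⟩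
    · exact ⟨0, 0, fun r hr => absurd ⟨r, hr⟩ hne⟩
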